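/- Let 𝔤 be a finite-dimensional real semisimple Lie algebra with Killing form B, and σ an involution of 𝔤 with 𝔥 := ker(σ − id), 𝔮 := ker(σ + id). Let 𝔱 ⊆ 𝔮 be a subspace such that the restriction of B to 𝔱 is nondegenerate, let 𝔱^⊥ := {X ∈ 𝔮 : B(X, 𝔱) = 0}, and assume that both 𝔱 and 𝔱^⊥ are Lie triple systems. Let 𝔫 := 𝔫_𝔥(𝔱) = {X ∈ 𝔥 : [X, 𝔱] ⊆ 𝔱}, assume B restricted to 𝔫 is nondegenerate, and let 𝔫^⊥ := {X ∈ 𝔥 : B(X, 𝔫) = 0}. Set 𝔥' := 𝔫 + 𝔱 and 𝔮' := 𝔫^⊥ + 𝔱^⊥. Then 𝔤 = 𝔥' ⊕ 𝔮' with B(𝔥', 𝔮') = 0, and [𝔥', 𝔥'] ⊆ 𝔥', [𝔥', 𝔮'] ⊆ 𝔮', [𝔮', 𝔮'] ⊆ 𝔥'; in particular 𝔥' is a Lie subalgebra of 𝔤 and (𝔥', 𝔮') is an orthogonal symmetric decomposition of 𝔤. (This is the key algebraic step in the proof of Theorem E, producing the symmetric subgroup of a Hermann type action from a reflective focal submanifold.)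 -/

import Mathlib

section

variable {𝔤 : Type*} [LieRing 𝔤] [LieAlgebra ℝ 𝔤]

/-- The `+1`-eigenspace `ker (σ - id)` of a linear involution. -/
def fixedSpace (σ : 𝔤 →ₗ⁅ℝ⁆ 𝔤) : Submodule ℝ 𝔤 :=
  LinearMap.ker (σ.toLinearMap - (LinearMap.id : 𝔤 →ₗ[ℝ] 𝔤))

/-- The `-1`-eigenspace `ker (σ + id)` of a linear involution. -/
def antifixedSpace (σ : 𝔤 →ₗ⁅ℝ⁆ 𝔤) : Submodule ℝ 𝔤 :=
  LinearMap.ker (σ.toLinearMap + (LinearMap.id : 𝔤 →ₗ[ℝ] 𝔤))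

/-- The normalizer `𝔫_V(W) = {X ∈ V : [X, W] ⊆ W}` of a subspace `W` in a subspace `V`;
note that `(-(ad w)) X = ⁅X, w⁆`. -/
def normalizerIn (V W : Submodule ℝ 𝔤) : Submodule ℝ 𝔤 :=
  V ⊓ ⨅ w ∈ W, Submodule.comap (-(LieAlgebra.ad ℝ 𝔤 w) : 𝔤 →ₗ[ℝ] 𝔤) W

/-- The orthogonal complement `{X ∈ V : B(X, W) = 0}` of a subspace `W` inside a subspace
`V`, with respect to the Killing form `B`; note that `B.flip Y X = B X Y`. -/
noncomputable def perpIn (V W : Submodule ℝ 𝔤) : Submodule ℝ 𝔤 :=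
  V ⊓ ⨅ Y ∈ W, LinearMap.ker ((killingForm ℝ 𝔤).flip Y)

end

section

variable {𝔤 : Type*} [LieRing 𝔤] [LieAlgebra ℝ 𝔤]

lemma mem_fixedSpace {σ : 𝔤 →ₗ⁅ℝ⁆ 𝔤} {X : 𝔤} : X ∈ fixedSpace σ ↔ σ X = X := by
  simp [fixedSpace, sub_eq_zero]

lemma mem_antifixedSpace {σ : 𝔤 →ₗ⁅ℝ⁆ 𝔤} {X : 𝔤} : X ∈ antifixedSpace σ ↔ σ X = -X := by
  simp [antifixedSpace, add_eq_zero_iff_eq_neg]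

lemma mem_normalizerIn {V W : Submodule ℝ 𝔤} {X : 𝔤} :
    X ∈ normalizerIn V W ↔ X ∈ V ∧ ∀ Y ∈ W, ⁅X, Y⁆ ∈ W := by
  simp only [normalizerIn, Submodule.mem_inf, Submodule.mem_iInf, Submodule.mem_comap,
    LinearMap.neg_apply, LieAlgebra.ad_apply, lie_skew]

lemma mem_perpIn {V W : Submodule ℝ 𝔤} {X : 𝔤} :
    X ∈ perpIn V W ↔ X ∈ V ∧ ∀ Y ∈ W, killingForm ℝ 𝔤 X Y = 0 := by
  simp only [perpIn, Submodule.mem_inf, Submodule.mem_iInf, LinearMap.mem_ker]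
  exact Iff.rfl

/-- The brackets of two sums of subspaces lie in a subspace as soon as the brackets of the
summands do. -/
lemma lie_mem_of_mem_sup {A₁ A₂ B₁ B₂ C : Submodule ℝ 𝔤}
    (h₁₁ : ∀ X ∈ A₁, ∀ Y ∈ B₁, ⁅X, Y⁆ ∈ C) (h₁₂ : ∀ X ∈ A₁, ∀ Y ∈ B₂, ⁅X, Y⁆ ∈ C)
    (h₂₁ : ∀ X ∈ A₂, ∀ Y ∈ B₁, ⁅X, Y⁆ ∈ C) (h₂₂ : ∀ X ∈ A₂, ∀ Y ∈ B₂, ⁅X, Y⁆ ∈ C) :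
    ∀ X ∈ A₁ ⊔ A₂, ∀ Y ∈ B₁ ⊔ B₂, ⁅X, Y⁆ ∈ C := by
  intro X hX Y hY
  obtain ⟨a₁, ha₁, a₂, ha₂, rfl⟩ := Submodule.mem_sup.mp hX
  obtain ⟨b₁, hb₁, b₂, hb₂, rfl⟩ := Submodule.mem_sup.mp hY
  rw [add_lie, lie_add, lie_add]
  exact C.add_mem (C.add_mem (h₁₁ _ ha₁ _ hb₁) (h₁₂ _ ha₁ _ hb₂))
    (C.add_mem (h₂₁ _ ha₂ _ hb₁) (h₂₂ _ ha₂ _ hb₂))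

/-- A subspace `W ≤ V` on which the Killing form is nondegenerate splits off orthogonally. -/
lemma sup_perpIn_eq [FiniteDimensional ℝ 𝔤] {V W : Submodule ℝ 𝔤} (hWV : W ≤ V)
    (hW : ∀ X ∈ W, (∀ Y ∈ W, killingForm ℝ 𝔤 X Y = 0) → X = 0) :
    W ⊔ perpIn V W = V := by
  have hcompl : IsCompl W ((killingForm ℝ 𝔤).orthogonal W) := by
    refine (LinearMap.BilinForm.isCompl_orthogonal_iff_disjoint
      (LieModule.traceForm_isSymm ℝ 𝔤 𝔤).isRefl).mpr (Submodule.disjoint_def.mpr ?_)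
    refine fun X hX hX' => hW X hX fun Y hY => ?_
    rw [LieModule.traceForm_comm]
    exact hX' Y hY
  refine le_antisymm (sup_le hWV inf_le_left) fun X hX => ?_
  obtain ⟨a, ha, b, hb, rfl⟩ :=
    Submodule.mem_sup.mp (hcompl.sup_eq_top ▸ Submodule.mem_top (x := X))
  refine Submodule.add_mem_sup ha (mem_perpIn.mpr ⟨(V.add_mem_iff_right (hWV ha)).mp hX, ?_⟩)
  intro Y hY
  rw [LieModule.traceForm_comm]
  exact hb Y hY

lemma fixedSpace_sup_antifixedSpace {σ : 𝔤 →ₗ⁅ℝ⁆ 𝔤} (hσ : ∀ X, σ (σ X) = X) :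
    fixedSpace σ ⊔ antifixedSpace σ = ⊤ := by
  refine eq_top_iff.mpr fun X _ => ?_
  have hX : X = (2⁻¹ : ℝ) • (X + σ X) + (2⁻¹ : ℝ) • (X - σ X) := by module
  rw [hX]
  refine Submodule.add_mem_sup (mem_fixedSpace.mpr ?_) (mem_antifixedSpace.mpr ?_)
  · rw [map_smul, map_add, hσ, add_comm]
  · rw [map_smul, map_sub, hσ, ← smul_neg, neg_sub]

lemma killingForm_fixedSpace_antifixedSpace {σ : 𝔤 →ₗ⁅ℝ⁆ 𝔤}
    (hσ : ∀ X, σ (σ X) = X) {X Y : 𝔤} (hX : X ∈ fixedSpace σ) (hY : Y ∈ antifixedSpace σ) :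
    killingForm ℝ 𝔤 X Y = 0 := by
  let e : 𝔤 ≃ₗ⁅ℝ⁆ 𝔤 := { σ with invFun := σ, left_inv := hσ, right_inv := hσ }
  have h : killingForm ℝ 𝔤 (σ X) (σ Y) = killingForm ℝ 𝔤 X Y :=
    LieAlgebra.killingForm_of_equiv_apply e X Y
  rw [mem_fixedSpace.mp hX, mem_antifixedSpace.mp hY, map_neg] at h
  linarith

end

/-- **Key algebraic step in the proof of Theorem E.**
Let `𝔤` be a finite-dimensional real semisimple Lie algebra with Killing form `B`, `σ` an
involution with `𝔥 := ker (σ - id)`, `𝔮 := ker (σ + id)`.  Let `𝔱 ⊆ 𝔮` be a subspace on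
which `B` is nondegenerate, `𝔱^⊥ := {X ∈ 𝔮 : B(X, 𝔱) = 0}`, and assume `𝔱` and `𝔱^⊥` are
Lie triple systems.  Let `𝔫 := 𝔫_𝔥(𝔱)`, assume `B` is nondegenerate on `𝔫`, and let
`𝔫^⊥ := {X ∈ 𝔥 : B(X, 𝔫) = 0}`.  Set `𝔥' := 𝔫 + 𝔱` and `𝔮' := 𝔫^⊥ + 𝔱^⊥`.  Then
`𝔤 = 𝔥' ⊕ 𝔮'` with `B(𝔥', 𝔮') = 0`, and `[𝔥', 𝔥'] ⊆ 𝔥'`, `[𝔥', 𝔮'] ⊆ 𝔮'`,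
`[𝔮', 𝔮'] ⊆ 𝔥'`. -/
theorem reflective_orthogonal_symmetric_decomposition
    (𝔤 : Type*) [LieRing 𝔤] [LieAlgebra ℝ 𝔤] [FiniteDimensional ℝ 𝔤]
    [LieAlgebra.IsSemisimple ℝ 𝔤]
    (σ : 𝔤 →ₗ⁅ℝ⁆ 𝔤) (hσinv : ∀ X, σ (σ X) = X)
    (𝔱 : Submodule ℝ 𝔤) (h𝔱q : 𝔱 ≤ antifixedSpace σ)
    (h𝔱nd : ∀ X ∈ 𝔱, (∀ Y ∈ 𝔱, killingForm ℝ 𝔤 X Y = 0) → X = 0)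
    (h𝔱lts : ∀ X ∈ 𝔱, ∀ Y ∈ 𝔱, ∀ Z ∈ 𝔱, ⁅⁅X, Y⁆, Z⁆ ∈ 𝔱)
    (h𝔱perplts : ∀ X ∈ perpIn (antifixedSpace σ) 𝔱, ∀ Y ∈ perpIn (antifixedSpace σ) 𝔱,
      ∀ Z ∈ perpIn (antifixedSpace σ) 𝔱, ⁅⁅X, Y⁆, Z⁆ ∈ perpIn (antifixedSpace σ) 𝔱)
    (h𝔫nd : ∀ X ∈ normalizerIn (fixedSpace σ) 𝔱,
      (∀ Y ∈ normalizerIn (fixedSpace σ) 𝔱, killingForm ℝ 𝔤 X Y = 0) → X = 0)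
    (𝔥' 𝔮' : Submodule ℝ 𝔤)
    (hh' : 𝔥' = normalizerIn (fixedSpace σ) 𝔱 ⊔ 𝔱)
    (hq' : 𝔮' = perpIn (fixedSpace σ) (normalizerIn (fixedSpace σ) 𝔱) ⊔
      perpIn (antifixedSpace σ) 𝔱) :
    𝔥' ⊔ 𝔮' = ⊤ ∧ 𝔥' ⊓ 𝔮' = ⊥ ∧
    (∀ X ∈ 𝔥', ∀ Y ∈ 𝔮', killingForm ℝ 𝔤 X Y = 0) ∧
    (∀ X ∈ 𝔥', ∀ Y ∈ 𝔥', ⁅X, Y⁆ ∈ 𝔥') ∧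
    (∀ X ∈ 𝔥', ∀ Y ∈ 𝔮', ⁅X, Y⁆ ∈ 𝔮') ∧
    (∀ X ∈ 𝔮', ∀ Y ∈ 𝔮', ⁅X, Y⁆ ∈ 𝔥') := by
  set 𝔥 := fixedSpace σ with h𝔥
  set 𝔮 := antifixedSpace σ with h𝔮
  set 𝔫 := normalizerIn 𝔥 𝔱
  set 𝔭 := perpIn 𝔮 𝔱
  set 𝔪 := perpIn 𝔥 𝔫
  have comm (X Y : 𝔤) : killingForm ℝ 𝔤 X Y = killingForm ℝ 𝔤 Y X :=
    LieModule.traceForm_comm ℝ 𝔤 𝔤 X Y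
  have inv (X Y Z : 𝔤) : killingForm ℝ 𝔤 ⁅X, Y⁆ Z = killingForm ℝ 𝔤 X ⁅Y, Z⁆ :=
    LieModule.traceForm_apply_lie_apply ℝ 𝔤 𝔤 X Y Z
  have swap {C : Submodule ℝ 𝔤} {X Y : 𝔤} (h : ⁅X, Y⁆ ∈ C) : ⁅Y, X⁆ ∈ C := by
    rw [← lie_skew]; exact C.neg_mem h
  have nondeg {X : 𝔤} (hX : ∀ Y, killingForm ℝ 𝔤 X Y = 0) : X = 0 :=
    (LieAlgebra.IsKilling.killingForm_nondegenerate ℝ 𝔤).1 X hX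
  have hhq {X Y : 𝔤} (hX : X ∈ 𝔥) (hY : Y ∈ 𝔮) : killingForm ℝ 𝔤 X Y = 0 :=
    killingForm_fixedSpace_antifixedSpace hσinv hX hY
  have hh {X Y : 𝔤} (hX : X ∈ 𝔥) (hY : Y ∈ 𝔥) : ⁅X, Y⁆ ∈ 𝔥 := by
    rw [h𝔥, mem_fixedSpace] at *
    rw [LieHom.map_lie, hX, hY]
  have hq {X Y : 𝔤} (hX : X ∈ 𝔥) (hY : Y ∈ 𝔮) : ⁅X, Y⁆ ∈ 𝔮 := by
    rw [h𝔥, mem_fixedSpace] at hX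
    rw [h𝔮, mem_antifixedSpace] at *
    rw [LieHom.map_lie, hX, hY, lie_neg]
  have qq {X Y : 𝔤} (hX : X ∈ 𝔮) (hY : Y ∈ 𝔮) : ⁅X, Y⁆ ∈ 𝔥 := by
    rw [h𝔮, mem_antifixedSpace] at hX hY
    rw [h𝔥, mem_fixedSpace, LieHom.map_lie, hX, hY, lie_neg, neg_lie, neg_neg]
  have h𝔫𝔥 : 𝔫 ≤ 𝔥 := inf_le_left
  have h𝔪𝔥 : 𝔪 ≤ 𝔥 := inf_le_left
  have h𝔭𝔮 : 𝔭 ≤ 𝔮 := inf_le_left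
  have h𝔱𝔭 : 𝔱 ⊔ 𝔭 = 𝔮 := sup_perpIn_eq h𝔱q h𝔱nd
  have h𝔫𝔪 : 𝔫 ⊔ 𝔪 = 𝔥 := sup_perpIn_eq h𝔫𝔥 h𝔫nd
  have htop : 𝔥 ⊔ 𝔮 = ⊤ := fixedSpace_sup_antifixedSpace hσinv
  have hpt {X Y : 𝔤} (hX : X ∈ 𝔭) (hY : Y ∈ 𝔱) : killingForm ℝ 𝔤 X Y = 0 :=
    (mem_perpIn.mp hX).2 Y hY
  have hmn {X Y : 𝔤} (hX : X ∈ 𝔪) (hY : Y ∈ 𝔫) : killingForm ℝ 𝔤 X Y = 0 :=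
    (mem_perpIn.mp hX).2 Y hY
  have mem_t {X : 𝔤} (hX : X ∈ 𝔮) (h : ∀ Y ∈ 𝔭, killingForm ℝ 𝔤 X Y = 0) : X ∈ 𝔱 := by
    obtain ⟨a, ha, b, hb, rfl⟩ := Submodule.mem_sup.mp (h𝔱𝔭 ▸ hX)
    suffices b = 0 by simpa [this] using ha
    have hbp (Y : 𝔤) (hY : Y ∈ 𝔭) : killingForm ℝ 𝔤 b Y = 0 := by
      have := h Y hY
      rwa [map_add, LinearMap.add_apply, comm a, hpt hY ha, zero_add] at this
    refine nondeg fun Z => ?_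
    obtain ⟨c, hc, d, hd, rfl⟩ := Submodule.mem_sup.mp (htop ▸ Submodule.mem_top (x := Z))
    obtain ⟨u, hu, v, hv, rfl⟩ := Submodule.mem_sup.mp (h𝔱𝔭 ▸ hd)
    rw [map_add, map_add, comm b c, hhq hc (h𝔭𝔮 hb), hpt hb hu, hbp v hv, add_zero, add_zero]
  have nt : ∀ X ∈ 𝔫, ∀ Y ∈ 𝔱, ⁅X, Y⁆ ∈ 𝔱 := fun X hX => (mem_normalizerIn.mp hX).2
  have nn : ∀ X ∈ 𝔫, ∀ Y ∈ 𝔫, ⁅X, Y⁆ ∈ 𝔫 := fun X hX Y hY =>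
    mem_normalizerIn.mpr ⟨hh (h𝔫𝔥 hX) (h𝔫𝔥 hY), fun Z hZ => by
      rw [lie_lie]
      exact 𝔱.sub_mem (nt X hX _ (nt Y hY Z hZ)) (nt Y hY _ (nt X hX Z hZ))⟩
  have tt : ∀ X ∈ 𝔱, ∀ Y ∈ 𝔱, ⁅X, Y⁆ ∈ 𝔫 := fun X hX Y hY =>
    mem_normalizerIn.mpr ⟨qq (h𝔱q hX) (h𝔱q hY), h𝔱lts X hX Y hY⟩
  have pp : ∀ X ∈ 𝔭, ∀ Y ∈ 𝔭, ⁅X, Y⁆ ∈ 𝔫 := fun X hX Y hY => by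
    have hXY := qq (h𝔭𝔮 hX) (h𝔭𝔮 hY)
    refine mem_normalizerIn.mpr ⟨hXY, fun Z hZ => mem_t (hq hXY (h𝔱q hZ)) fun W hW => ?_⟩
    rw [← lie_skew, map_neg, LinearMap.neg_apply, inv, comm, hpt (h𝔱perplts X hX Y hY W hW) hZ,
      neg_zero]
  have np : ∀ X ∈ 𝔫, ∀ Y ∈ 𝔭, ⁅X, Y⁆ ∈ 𝔭 := fun X hX Y hY =>
    mem_perpIn.mpr ⟨hq (h𝔫𝔥 hX) (h𝔭𝔮 hY), fun Z hZ => by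
      rw [← lie_skew, map_neg, LinearMap.neg_apply, inv, hpt hY (nt X hX Z hZ), neg_zero]⟩
  have nm : ∀ X ∈ 𝔫, ∀ Y ∈ 𝔪, ⁅X, Y⁆ ∈ 𝔪 := fun X hX Y hY =>
    mem_perpIn.mpr ⟨hh (h𝔫𝔥 hX) (h𝔪𝔥 hY), fun Z hZ => by
      rw [← lie_skew, map_neg, LinearMap.neg_apply, inv, hmn hY (nn X hX Z hZ), neg_zero]⟩
  have mt : ∀ X ∈ 𝔪, ∀ Y ∈ 𝔱, ⁅X, Y⁆ ∈ 𝔭 := fun X hX Y hY =>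
    mem_perpIn.mpr ⟨hq (h𝔪𝔥 hX) (h𝔱q hY), fun Z hZ => by
      rw [inv, hmn hX (tt Y hY Z hZ)]⟩
  have pt : ∀ X ∈ 𝔭, ∀ Y ∈ 𝔱, ⁅X, Y⁆ ∈ 𝔪 := fun X hX Y hY =>
    mem_perpIn.mpr ⟨qq (h𝔭𝔮 hX) (h𝔱q hY), fun Z hZ => by
      rw [inv, hpt hX (swap (nt Z hZ Y hY))]⟩
  have mp : ∀ X ∈ 𝔪, ∀ Y ∈ 𝔭, ⁅X, Y⁆ ∈ 𝔱 := fun X hX Y hY =>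
    mem_t (hq (h𝔪𝔥 hX) (h𝔭𝔮 hY)) fun Z hZ => by rw [inv, hmn hX (pp Y hY Z hZ)]
  have mm : ∀ X ∈ 𝔪, ∀ Y ∈ 𝔪, ⁅X, Y⁆ ∈ 𝔫 := fun X hX Y hY =>
    mem_normalizerIn.mpr ⟨hh (h𝔪𝔥 hX) (h𝔪𝔥 hY), fun Z hZ => by
      rw [lie_lie]
      exact 𝔱.sub_mem (mp X hX _ (mt Y hY Z hZ)) (mp Y hY _ (mt X hX Z hZ))⟩
  have hsup : 𝔥' ⊔ 𝔮' = ⊤ := by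
    rw [hh', hq', sup_sup_sup_comm, h𝔫𝔪, h𝔱𝔭, htop]
  have horth : ∀ X ∈ 𝔥', ∀ Y ∈ 𝔮', killingForm ℝ 𝔤 X Y = 0 := by
    intro X hX Y hY
    obtain ⟨a, ha, b, hb, rfl⟩ := Submodule.mem_sup.mp (hh' ▸ hX)
    obtain ⟨c, hc, d, hd, rfl⟩ := Submodule.mem_sup.mp (hq' ▸ hY)
    simp only [map_add, LinearMap.add_apply]
    rw [comm a c, hmn hc ha, hhq (h𝔫𝔥 ha) (h𝔭𝔮 hd), comm b c, hhq (h𝔪𝔥 hc) (h𝔱q hb),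
      comm b d, hpt hd hb]
    simp
  refine ⟨hsup, ?_, horth, ?_, ?_, ?_⟩
  · refine eq_bot_iff.mpr fun X hX => nondeg fun Z => ?_
    obtain ⟨a, ha, b, hb, rfl⟩ := Submodule.mem_sup.mp (hsup ▸ Submodule.mem_top (x := Z))
    rw [map_add, comm X a, horth a ha X hX.2, horth X hX.1 b hb, add_zero]
  · rw [hh']
    exact lie_mem_of_mem_sup
      (fun X hX Y hY => Submodule.mem_sup_left (nn X hX Y hY))
      (fun X hX Y hY => Submodule.mem_sup_right (nt X hX Y hY))
      (fun X hX Y hY => Submodule.mem_sup_right (swap (nt Y hY X hX)))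
      (fun X hX Y hY => Submodule.mem_sup_left (tt X hX Y hY))
  · rw [hh', hq']
    exact lie_mem_of_mem_sup
      (fun X hX Y hY => Submodule.mem_sup_left (nm X hX Y hY))
      (fun X hX Y hY => Submodule.mem_sup_right (np X hX Y hY))
      (fun X hX Y hY => Submodule.mem_sup_right (swap (mt Y hY X hX)))
      (fun X hX Y hY => Submodule.mem_sup_left (swap (pt Y hY X hX)))
  · rw [hh', hq']
    exact lie_mem_of_mem_sup
      (fun X hX Y hY => Submodule.mem_sup_left (mm X hX Y hY))
      (fun X hX Y hY => Submodule.mem_sup_right (mp X hX Y hY))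
      (fun X hX Y hY => Submodule.mem_sup_right (swap (mp Y hY X hX)))
      (fun X hX Y hY => Submodule.mem_sup_left (pp X hX Y hY))
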